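/- Let G be a finite simple connected graph with nonempty sink Z. For any starting vertex a and any initial rotor configuration ρ, the occupation rate S_n(ρ,x)/n converges, as n → ∞, to the Green function G(a,x), the expected number of visits to x strictly before hitting Z by the simple random walk started at a. -/

import Mathlib

open MeasureTheory Filter ENNReal Set

namespace RotorWalk

variable {V : Type*} [DecidableEq V]

/-- One step of the rotor walk with local mechanisms `τ`:
the rotor at the current position is advanced and the walker follows it. -/
def step (τ : V → V → V) (p : V × (V → V)) : V × (V → V) :=
  (τ p.1 (p.2 p.1), Function.update p.2 p.1 (τ p.1 (p.2 p.1)))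

/-- Trajectory (position, rotor configuration) of the rotor walk started at `a`
with initial rotor configuration `ρ`. -/
def traj (τ : V → V → V) (a : V) (ρ : V → V) : ℕ → V × (V → V)
  | 0 => (a, ρ)
  | t + 1 => step τ (traj τ a ρ t)

/-- Position of the walker at time `t`. -/
def pos (τ : V → V → V) (a : V) (ρ : V → V) (t : ℕ) : V := (traj τ a ρ t).1

/-- Rotor configuration at time `t`. -/
def conf (τ : V → V → V) (a : V) (ρ : V → V) (t : ℕ) : V → V := (traj τ a ρ t).2

/-- The walk has not hit the sink `Z` up to and including time `t`. -/
def aliveAt (τ : V → V → V) (Z : Set V) (a : V) (ρ : V → V) (t : ℕ) : Prop :=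
  ∀ s ≤ t, pos τ a ρ s ∉ Z

/-- Odometer: the number of visits to `x` strictly before hitting the sink `Z`. -/
noncomputable def odometer (τ : V → V → V) (Z : Set V) (a : V) (ρ : V → V) (x : V) : ℕ∞ :=
  {t : ℕ | aliveAt τ Z a ρ t ∧ pos τ a ρ t = x}.encard

/-- Number of traversals of the directed edge `(y, x)` strictly before hitting `Z`. -/
noncomputable def edgeCount (τ : V → V → V) (Z : Set V) (a : V) (ρ : V → V) (y x : V) : ℕ∞ :=
  {t : ℕ | aliveAt τ Z a ρ t ∧ pos τ a ρ t = y ∧ pos τ a ρ (t + 1) = x}.encard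

open Classical in
/-- The final rotor configuration: the configuration at the hitting time of `Z` if the walk
hits `Z`, and otherwise the pointwise eventual value of the rotor configuration
(which exists when the walk is transient). -/
noncomputable def finalConf (τ : V → V → V) (Z : Set V) (a : V) (ρ : V → V) : V → V :=
  if ∃ t, pos τ a ρ t ∈ Z then conf τ a ρ (sInf {t | pos τ a ρ t ∈ Z})
  else fun x => if h : ∃ v, ∀ᶠ t in atTop, conf τ a ρ t x = v then h.choose else ρ x

/-- Total number of visits to `x` by `n` sequential rotor walks (rotors not reset). -/
noncomputable def Svis (τ : V → V → V) (Z : Set V) (a : V) (ρ : V → V) (n : ℕ) (x : V) : ℕ∞ :=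
  ∑ i ∈ Finset.range n, odometer τ Z a ((finalConf τ Z a)^[i] ρ) x

/-- Total number of traversals of the directed edge `(y,x)` by `n` sequential rotor walks. -/
noncomputable def Sedge (τ : V → V → V) (Z : Set V) (a : V) (ρ : V → V) (n : ℕ) (y x : V) : ℕ∞ :=
  ∑ i ∈ Finset.range n, edgeCount τ Z a ((finalConf τ Z a)^[i] ρ) y x

/-- The rotor walk is transient: every vertex is visited finitely often (before hitting `Z`). -/
def IsTransientWalk (τ : V → V → V) (Z : Set V) (a : V) (ρ : V → V) : Prop :=
  ∀ x : V, {t : ℕ | aliveAt τ Z a ρ t ∧ pos τ a ρ t = x}.Finite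

open Classical in
/-- Total number of visits to `x` by `n` sequential rotor walks with empty sink,
set to `⊤` if one of the `n` walks fails to be transient. -/
noncomputable def SvisT (τ : V → V → V) (a : V) (ρ : V → V) (n : ℕ) (x : V) : ℕ∞ :=
  if ∀ i < n, IsTransientWalk τ ∅ a ((finalConf τ ∅ a)^[i] ρ) then Svis τ ∅ a ρ n x else ⊤

/-- The local mechanisms map neighbors to neighbors and have a single orbit on each
neighborhood (off the sink). -/
def ValidMechanism (G : SimpleGraph V) (Z : Set V) (τ : V → V → V) : Prop :=
  ∀ x ∉ Z, (∀ y, G.Adj x y → G.Adj x (τ x y)) ∧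
    ∀ y, G.Adj x y → ∀ z, G.Adj x z → ∃ i : ℕ, (τ x)^[i] y = z

/-- A rotor configuration: every rotor (off the sink) points to a neighbor. -/
def ValidConfig (G : SimpleGraph V) (Z : Set V) (ρ : V → V) : Prop :=
  ∀ x ∉ Z, G.Adj x (ρ x)

/-- Time-`t` distribution of the simple random walk started at `a` and killed on `Z`. -/
noncomputable def srw (G : SimpleGraph V) [G.LocallyFinite] (Z : Set V) (a : V) :
    ℕ → V → ℝ≥0∞
  | 0 => Set.indicator {a} 1
  | t + 1 => fun x =>
      ∑' y : V, Set.indicator {y | G.Adj y x ∧ y ∉ Z}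
        (fun y => srw G Z a t y / (G.degree y : ℝ≥0∞)) y

/-- Green function: the expected number of visits to a vertex, strictly before hitting `Z`,
of the simple random walk started at `a`. -/
noncomputable def green (G : SimpleGraph V) [G.LocallyFinite] (Z : Set V) (a : V) : V → ℝ≥0∞ :=
  Set.indicator Zᶜ (fun x => ∑' t : ℕ, srw G Z a t x)

/-- The graph is transient: the Green function (with empty sink) is finite. -/
def TransientGraph (G : SimpleGraph V) [G.LocallyFinite] : Prop :=
  ∀ a x : V, green G ∅ a x < ⊤

/-- A `Z`-oriented spanning forest, encoded as a rotor configuration: off `Z` it points to a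
neighbor, on `Z` it is normalized to the identity, and every vertex eventually reaches `Z`. -/
def IsOSF (G : SimpleGraph V) (Z : Set V) (ρ : V → V) : Prop :=
  (∀ x ∉ Z, G.Adj x (ρ x)) ∧ (∀ x ∈ Z, ρ x = x) ∧ ∀ x : V, ∃ n : ℕ, ρ^[n] x ∈ Z

/-- An oriented spanning forest of an infinite graph: every vertex has out-degree one along
an edge and there is no directed cycle. -/
def IsOSFInf (G : SimpleGraph V) (ρ : V → V) : Prop :=
  (∀ x, G.Adj x (ρ x)) ∧ ∀ x : V, ∀ n > 0, ρ^[n] x ≠ x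

/-- A spanning forest of the ball of radius `R` around `a`, oriented toward the boundary
sphere (the sink), normalized to the identity outside the open ball. -/
def IsOSFBall (G : SimpleGraph V) (a : V) (R : ℕ) (ρ : V → V) : Prop :=
  (∀ x, G.dist a x < R → G.Adj x (ρ x)) ∧
  (∀ x, ¬ G.dist a x < R → ρ x = x) ∧
  ∀ x, G.dist a x < R → ∃ n : ℕ, G.dist a (ρ^[n] x) = R

instance : MeasurableSpace (V → V) := ⊤

/-- `μ` is the oriented wired uniform spanning forest measure of `G` (with respect to the
exhaustion by balls around `a`): it is a probability measure supported on oriented spanning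
forests whose finite-dimensional marginals are the limits of the uniform measures on
boundary-oriented spanning forests of the balls. -/
def IsOWUSF (G : SimpleGraph V) (a : V) (μ : Measure (V → V)) : Prop :=
  IsProbabilityMeasure μ ∧
  (∀ᵐ ρ ∂μ, IsOSFInf G ρ) ∧
  ∀ B : Finset (V × V),
    Tendsto (fun R : ℕ =>
        (({ρ : V → V | IsOSFBall G a R ρ ∧ ∀ e ∈ B, ρ e.1 = e.2}.ncard : ℝ) /
          ({ρ : V → V | IsOSFBall G a R ρ}.ncard : ℝ))) atTop
      (nhds ((μ {ρ : V → V | ∀ e ∈ B, ρ e.1 = e.2}).toReal))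

/-- Vertex-transitivity. -/
def VertexTransitive (G : SimpleGraph V) : Prop :=
  ∀ u v : V, ∃ φ : G ≃g G, φ u = v

/-- `μ` is stationary for the rotor walk (empty sink) started at `a`: almost every walk is
transient and the final rotor configuration again has law `μ`. -/
def RWStationary (τ : V → V → V) (a : V) (μ : Measure (V → V)) : Prop :=
  (∀ᵐ ρ ∂μ, IsTransientWalk τ ∅ a ρ) ∧ μ.map (finalConf τ ∅ a) = μ

section Helpers

variable {V : Type*} [DecidableEq V]

open Classical in
lemma exists_pot (G : SimpleGraph V) [G.LocallyFinite] (Z : Set V)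
    (τ : V → V → V) (hτ : ValidMechanism G Z τ) (y : V) (hy : y ∉ Z)
    (g : V → ℝ) (hg : ∑ z ∈ G.neighborFinset y, g z = 0) :
    ∃ φ : V → ℝ, ∀ z, G.Adj y z → φ (τ y z) - φ z = g (τ y z) := by
  obtain ⟨h1, h2⟩ := hτ y hy
  have hadj : ∀ z, G.Adj y z → ∀ k, G.Adj y ((τ y)^[k] z) := by
    intro z hz k
    induction k with
    | zero => simpa using hz
    | succ k ih => rw [Function.iterate_succ_apply']; exact h1 _ ih
  have hper : ∀ z, G.Adj y z → z ∈ Function.periodicPts (τ y) := by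
    intro z hz
    obtain ⟨i, hi⟩ := h2 _ (h1 z hz) z hz
    exact ⟨i + 1, Nat.succ_pos _, by
      rw [Function.IsPeriodicPt, Function.IsFixedPt, Function.iterate_succ_apply]; exact hi⟩
  have himg : ∀ z, G.Adj y z →
      (Finset.range (Function.minimalPeriod (τ y) z)).image (fun k => (τ y)^[k] z)
        = G.neighborFinset y := by
    intro z hz
    ext w
    simp only [Finset.mem_image, Finset.mem_range, SimpleGraph.mem_neighborFinset]
    constructor
    · rintro ⟨k, -, rfl⟩; exact hadj z hz k
    · intro hw
      obtain ⟨i, hi⟩ := h2 z hz w hw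
      refine ⟨i % Function.minimalPeriod (τ y) z, Nat.mod_lt _
        (Function.minimalPeriod_pos_of_mem_periodicPts (hper z hz)), ?_⟩
      rw [Function.iterate_mod_minimalPeriod_eq, hi]
  have hinj : ∀ z, Set.InjOn (fun k => (τ y)^[k] z)
      (Finset.range (Function.minimalPeriod (τ y) z) : Set ℕ) := by
    intro z
    rw [Finset.coe_range]
    exact Function.iterate_injOn_Iio_minimalPeriod
  have hd : ∀ z, G.Adj y z → Function.minimalPeriod (τ y) z = G.degree y := by
    intro z hz
    have := congrArg Finset.card (himg z hz)
    rw [Finset.card_image_of_injOn (hinj z), Finset.card_range,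
      SimpleGraph.card_neighborFinset_eq_degree] at this
    exact this
  have hsum : ∀ z, G.Adj y z → ∑ k ∈ Finset.range (G.degree y), g ((τ y)^[k] z) = 0 := by
    intro z hz
    rw [← hg, ← himg z hz, Finset.sum_image (hinj z), hd z hz]
  have hfix : ∀ z, G.Adj y z → (τ y)^[G.degree y] z = z := by
    intro z hz
    rw [← hd z hz]; exact Function.iterate_minimalPeriod
  have key : ∀ (n : ℕ) (u : ℕ → ℝ), ∑ k ∈ Finset.range n, (k : ℝ) * u (k + 1)
      - ∑ k ∈ Finset.range n, (k : ℝ) * u k = n * u n - ∑ k ∈ Finset.range n, u (k + 1) := by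
    intro n u
    induction n with
    | zero => simp
    | succ n ih =>
      simp only [Finset.sum_range_succ]
      push_cast
      linarith
  refine ⟨fun z => (∑ k ∈ Finset.range (G.degree y), (k : ℝ) * g ((τ y)^[k] (τ y z)))
    / G.degree y, ?_⟩
  intro z hz
  have hpos : (0 : ℝ) < G.degree y := by
    have := (G.degree_pos_iff_exists_adj y).2 ⟨z, hz⟩
    exact_mod_cast this
  have hz1 := h1 z hz
  have k1 := key (G.degree y) (fun k => g ((τ y)^[k] (τ y z)))
  have s1 := hsum _ (h1 _ hz1)
  simp only [Function.iterate_succ_apply, hfix _ hz1] at k1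
  rw [s1] at k1
  simp only
  rw [← sub_div, k1]
  field_simp
  ring

lemma exists_h [Fintype V] (G : SimpleGraph V) [G.LocallyFinite] (hconn : G.Connected)
    (Z : Set V) (hZ : Z.Nonempty) (hdeg : ∀ y ∉ Z, (0 : ℝ) < G.degree y) (f : V → ℝ) :
    ∃ h : V → ℝ, (∀ z ∈ Z, h z = 0) ∧
      ∀ y ∉ Z, (∑ z ∈ G.neighborFinset y, h z) / G.degree y = h y - f y := by
  classical
  let L : (V → ℝ) →ₗ[ℝ] (V → ℝ) :=
    { toFun := fun h y => if y ∈ Z then h y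
        else h y - (∑ z ∈ G.neighborFinset y, h z) / G.degree y
      map_add' := by
        intro u v; ext y
        by_cases hy : y ∈ Z
        · simp [hy]
        · simp [hy, Finset.sum_add_distrib, add_div]; ring
      map_smul' := by
        intro c u; ext y
        by_cases hy : y ∈ Z
        · simp [hy]
        · simp [hy, ← Finset.mul_sum, mul_div_assoc]; ring }
  have hL : ∀ h y, L h y = if y ∈ Z then h y
        else h y - (∑ z ∈ G.neighborFinset y, h z) / G.degree y := fun _ _ => rfl
  have hle : ∀ h, L h = 0 → ∀ y, h y ≤ 0 := by
    intro h hh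
    have : Nonempty V := ⟨hZ.some⟩
    obtain ⟨m, hm⟩ := Finite.exists_max h
    by_contra hcon
    push Not at hcon
    obtain ⟨w, hw⟩ := hcon
    have hmpos : 0 < h m := lt_of_lt_of_le hw (hm w)
    have hnz : ∀ y, h y = h m → y ∉ Z := by
      intro y hy hyZ
      have := congrFun hh y
      rw [hL, if_pos hyZ] at this
      simp at this
      linarith
    have hstep : ∀ y z, G.Adj y z → h y = h m → h z = h m := by
      intro y z hyz hy
      have hyZ := hnz y hy
      have e := congrFun hh y
      rw [hL, if_neg hyZ] at e
      have hd := hdeg y hyZ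
      simp only [Pi.zero_apply] at e
      have e2 : ∑ z ∈ G.neighborFinset y, h z = G.degree y * h m := by
        have : (∑ z ∈ G.neighborFinset y, h z) / G.degree y = h m := by linarith
        rw [div_eq_iff hd.ne'] at this
        linarith
      have e3 : ∑ z ∈ G.neighborFinset y, (h m - h z) = 0 := by
        rw [Finset.sum_sub_distrib, e2]
        simp
      rw [Finset.sum_eq_zero_iff_of_nonneg (fun i _ => by linarith [hm i])] at e3
      have := e3 z (by simpa using hyz)
      linarith
    have hall : ∀ y, h y = h m := by
      intro y
      obtain ⟨p⟩ := hconn.preconnected m y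
      have : ∀ {u v : V} (p : G.Walk u v), h u = h m → h v = h m := by
        intro u v p
        induction p with
        | nil => exact id
        | cons hadj _ ih => exact fun hu => ih (hstep _ _ hadj hu)
      exact this p rfl
    obtain ⟨z, hz⟩ := hZ
    exact hnz z (hall z) hz
  have hinj : Function.Injective L := by
    rw [injective_iff_map_eq_zero]
    intro h hh
    ext y
    have a1 := hle h hh y
    have a2 := hle (-h) (by rw [map_neg, hh, neg_zero]) y
    simp only [Pi.neg_apply] at a2
    simp only [Pi.zero_apply]
    linarith
  obtain ⟨h, hh⟩ := (LinearMap.injective_iff_surjective.1 hinj) (fun y => if y ∈ Z then 0 else f y)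
  refine ⟨h, ?_, ?_⟩
  · intro z hz
    have := congrFun hh z
    simpa [hL, hz] using this
  · intro y hy
    have := congrFun hh y
    simp only [hL, hy, if_false] at this
    linarith

lemma exists_Psi [Fintype V] (G : SimpleGraph V) [G.LocallyFinite] (Z : Set V)
    (hdeg : ∀ y ∉ Z, (0 : ℝ) < G.degree y)
    (τ : V → V → V) (hτ : ValidMechanism G Z τ) (f h : V → ℝ)
    (hh : ∀ y ∉ Z, (∑ z ∈ G.neighborFinset y, h z) / G.degree y = h y - f y) :
    ∃ Ψ : (V → V) → ℝ, ∀ y ∉ Z, ∀ ρ, ValidConfig G Z ρ →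
      h (τ y (ρ y)) + Ψ (Function.update ρ y (τ y (ρ y))) = h y - f y + Ψ ρ := by
  have hex : ∀ y, ∃ φ : V → ℝ, y ∉ Z → ∀ z, G.Adj y z →
      φ (τ y z) - φ z = (h y - f y) - h (τ y z) := by
    intro y
    by_cases hy : y ∈ Z
    · exact ⟨0, fun h => absurd hy h⟩
    · obtain ⟨φ, hφ⟩ := exists_pot G Z τ hτ y hy (fun z => (h y - f y) - h z) (by
        have hd := hdeg y hy
        have := hh y hy
        rw [div_eq_iff hd.ne'] at this
        rw [Finset.sum_sub_distrib, this]
        simp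
        ring)
      exact ⟨φ, fun _ => hφ⟩
  choose φ hφ using hex
  refine ⟨fun ρ => ∑ y, φ y (ρ y), ?_⟩
  intro y hy ρ hρ
  have e := hφ y hy (ρ y) (hρ y hy)
  have h1 : ∑ w, φ w (Function.update ρ y (τ y (ρ y)) w) - ∑ w, φ w (ρ w)
      = φ y (τ y (ρ y)) - φ y (ρ y) := by
    rw [← Finset.sum_sub_distrib, Finset.sum_eq_single y]
    · simp
    · intro b _ hb
      simp [hb]
    · simp
  simp only
  linarith

lemma traj_inv (G : SimpleGraph V) [G.LocallyFinite] (Z : Set V)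
    (τ : V → V → V) (hτ : ValidMechanism G Z τ) (f h : V → ℝ) (Ψ : (V → V) → ℝ)
    (hΨ : ∀ y ∉ Z, ∀ ρ, ValidConfig G Z ρ →
      h (τ y (ρ y)) + Ψ (Function.update ρ y (τ y (ρ y))) = h y - f y + Ψ ρ)
    (a : V) (ρ : V → V) (hρ : ValidConfig G Z ρ) (t : ℕ) (ht : ∀ s < t, pos τ a ρ s ∉ Z) :
    ValidConfig G Z (conf τ a ρ t) ∧
    h (pos τ a ρ t) + Ψ (conf τ a ρ t) = h a + Ψ ρ - ∑ s ∈ Finset.range t, f (pos τ a ρ s) := by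
  induction t with
  | zero => exact ⟨hρ, by simp [pos, conf, traj]⟩
  | succ t ih =>
    obtain ⟨i1, i2⟩ := ih (fun s hs => ht s (by omega))
    have hy := ht t (by omega)
    have e1 : pos τ a ρ (t + 1) = τ (pos τ a ρ t) (conf τ a ρ t (pos τ a ρ t)) := rfl
    have e2 : conf τ a ρ (t + 1) = Function.update (conf τ a ρ t) (pos τ a ρ t)
      (τ (pos τ a ρ t) (conf τ a ρ t (pos τ a ρ t))) := rfl
    constructor
    · rw [e2]
      intro y hyZ
      by_cases hyp : y = pos τ a ρ t
      · rw [hyp, Function.update_self]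
        exact (hτ _ hy).1 _ (i1 _ hy)
      · rw [Function.update_of_ne hyp]
        exact i1 y hyZ
    · rw [e1, e2, hΨ _ hy _ i1, Finset.sum_range_succ]
      linarith

lemma hits [Fintype V] (G : SimpleGraph V) [G.LocallyFinite] (hconn : G.Connected)
    (Z : Set V) (hZ : Z.Nonempty) (hdeg : ∀ y ∉ Z, (0 : ℝ) < G.degree y)
    (τ : V → V → V) (hτ : ValidMechanism G Z τ)
    (a : V) (ρ : V → V) (hρ : ValidConfig G Z ρ) : ∃ t, pos τ a ρ t ∈ Z := by
  obtain ⟨h, -, hh⟩ := exists_h G hconn Z hZ hdeg (fun _ => 1)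
  obtain ⟨Ψ, hΨ⟩ := exists_Psi G Z hdeg τ hτ (fun _ => 1) h hh
  by_contra hcon
  push Not at hcon
  have : Nonempty V := ⟨a⟩
  obtain ⟨m, hm⟩ := Finite.exists_min h
  obtain ⟨m', hm'⟩ := Finite.exists_min Ψ
  obtain ⟨n, hn⟩ := exists_nat_gt (h a + Ψ ρ - h m - Ψ m')
  have := (traj_inv G Z τ hτ _ h Ψ hΨ a ρ hρ n (fun s _ => hcon s)).2
  simp at this
  linarith [hm (pos τ a ρ n), hm' (conf τ a ρ n)]

lemma odo [Fintype V] (G : SimpleGraph V) [G.LocallyFinite] (hconn : G.Connected)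
    (Z : Set V) (hZ : Z.Nonempty) (hdeg : ∀ y ∉ Z, (0 : ℝ) < G.degree y)
    (τ : V → V → V) (hτ : ValidMechanism G Z τ) (x : V)
    (h : V → ℝ) (Ψ : (V → V) → ℝ) (hz : ∀ z ∈ Z, h z = 0)
    (hΨ : ∀ y ∉ Z, ∀ ρ, ValidConfig G Z ρ →
      h (τ y (ρ y)) + Ψ (Function.update ρ y (τ y (ρ y)))
        = h y - (if y = x then 1 else 0) + Ψ ρ)
    (a : V) (ρ : V → V) (hρ : ValidConfig G Z ρ) :
    ValidConfig G Z (finalConf τ Z a ρ) ∧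
    ∃ m : ℕ, odometer τ Z a ρ x = m ∧ (m : ℝ) = h a + Ψ ρ - Ψ (finalConf τ Z a ρ) := by
  have hex := hits G hconn Z hZ hdeg τ hτ a ρ hρ
  have hne : {t | pos τ a ρ t ∈ Z}.Nonempty := hex
  have hfc : finalConf τ Z a ρ = conf τ a ρ (sInf {t | pos τ a ρ t ∈ Z}) := by
    rw [finalConf, if_pos hex]
  set T := sInf {t | pos τ a ρ t ∈ Z} with hT
  have hTm : pos τ a ρ T ∈ Z := Nat.sInf_mem hne
  have hTl : ∀ s < T, pos τ a ρ s ∉ Z := fun s hs => Nat.notMem_of_lt_sInf hs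
  obtain ⟨i1, i2⟩ := traj_inv G Z τ hτ (fun y => if y = x then 1 else 0) h Ψ hΨ a ρ hρ T hTl
  rw [hfc]
  refine ⟨i1, ((Finset.range T).filter (fun t => pos τ a ρ t = x)).card, ?_, ?_⟩
  · rw [odometer, ← Set.encard_coe_eq_coe_finsetCard]
    congr 1
    ext t
    simp only [Set.mem_setOf_eq, Finset.coe_filter, Finset.mem_range]
    refine and_congr_left fun _ => ⟨?_, ?_⟩
    · intro hal
      by_contra hc
      exact hal T (by omega) hTm
    · intro hlt s hs
      exact hTl s (by omega)
  · rw [hz _ hTm, Finset.sum_boole] at i2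
    linarith

lemma srw_ne_top [Fintype V] (G : SimpleGraph V) [G.LocallyFinite] (Z : Set V)
    (hdeg : ∀ y ∉ Z, (0 : ℝ) < G.degree y) (a : V) (t : ℕ) (x : V) : srw G Z a t x ≠ ⊤ := by
  classical
  induction t generalizing x with
  | zero => 
    simp only [srw, Set.indicator_apply]
    split_ifs <;> simp
  | succ t ih =>
    simp only [srw, tsum_fintype]
    rw [ENNReal.sum_ne_top]
    intro y _
    rw [Set.indicator_apply]
    split_ifs with hy
    · refine ENNReal.div_ne_top (ih y) ?_
      have := hdeg y hy.2
      have : G.degree y ≠ 0 := by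
        intro h0; rw [h0] at this; simp at this
      exact_mod_cast this
    · simp

open Classical in
lemma srw_rec [Fintype V] (G : SimpleGraph V) [G.LocallyFinite] (Z : Set V)
    (hdeg : ∀ y ∉ Z, (0 : ℝ) < G.degree y) (a : V) (t : ℕ) (u : V → ℝ) :
    ∑ x, (srw G Z a (t + 1) x).toReal * u x
      = ∑ y, if y ∈ Z then 0 else (srw G Z a t y).toReal *
          ((∑ z ∈ G.neighborFinset y, u z) / G.degree y) := by
  have h1 : ∀ x, (srw G Z a (t + 1) x).toReal
      = ∑ y, if G.Adj y x ∧ y ∉ Z then (srw G Z a t y).toReal / G.degree y else 0 := by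
    intro x
    have hx := srw_ne_top G Z hdeg a (t + 1) x
    simp only [srw, tsum_fintype] at hx ⊢
    rw [ENNReal.sum_ne_top] at hx
    rw [ENNReal.toReal_sum hx]
    refine Finset.sum_congr rfl fun y _ => ?_
    rw [Set.indicator_apply]
    simp only [Set.mem_setOf_eq]
    split_ifs <;> simp
  simp_rw [h1, Finset.sum_mul]
  rw [Finset.sum_comm]
  refine Finset.sum_congr rfl fun y _ => ?_
  by_cases hy : y ∈ Z
  · simp [hy]
  · simp only [hy, not_false_eq_true, and_true, if_false, ite_mul, zero_mul]
    rw [← Finset.sum_filter, Finset.sum_div, Finset.mul_sum]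
    refine Finset.sum_congr ?_ fun z _ => by ring
    ext z
    simp

lemma green_eq [Fintype V] (G : SimpleGraph V) [G.LocallyFinite] (hconn : G.Connected)
    (Z : Set V) (hZ : Z.Nonempty) (hdeg : ∀ y ∉ Z, (0 : ℝ) < G.degree y) (a x : V) (hx : x ∉ Z)
    (h : V → ℝ) (hz : ∀ z ∈ Z, h z = 0)
    (hh : ∀ y ∉ Z, (∑ z ∈ G.neighborFinset y, h z) / G.degree y
      = h y - (if y = x then 1 else 0)) :
    green G Z a x = ENNReal.ofReal (h a) := by
  classical
  set q : ℕ → V → ℝ := fun t y => (srw G Z a t y).toReal with hq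
  have q0 : ∀ t y, 0 ≤ q t y := fun _ _ => ENNReal.toReal_nonneg
  have qz : ∀ u : V → ℝ, ∑ y, q 0 y * u y = u a := by
    intro u
    rw [Finset.sum_eq_single a]
    · simp [hq, srw]
    · intro b _ hb; simp [hq, srw, hb]
    · simp
  -- telescoping
  have tel : ∀ (f k : V → ℝ), (∀ z ∈ Z, k z = 0) →
      (∀ y ∉ Z, (∑ z ∈ G.neighborFinset y, k z) / G.degree y = k y - f y) → ∀ n,
      ∑ t ∈ Finset.range n, (∑ y, if y ∈ Z then 0 else q t y * f y) = k a - ∑ y, q n y * k y := by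
    intro f k hkz hk n
    induction n with
    | zero => simp [qz]
    | succ n ih =>
      rw [Finset.sum_range_succ, ih, srw_rec G Z hdeg a n k]
      have : ∑ y, q n y * k y = (∑ y, if y ∈ Z then 0 else q n y * f y)
          + ∑ y, if y ∈ Z then 0 else q n y * ((∑ z ∈ G.neighborFinset y, k z) / G.degree y) := by
        rw [← Finset.sum_add_distrib]
        refine Finset.sum_congr rfl fun y _ => ?_
        by_cases hy : y ∈ Z
        · simp [hy, hkz y hy]
        · simp only [hy, if_false, hk y hy]; ring
      rw [this]
      ring
  have mass : ∀ n, ∑ y, q n y ≤ 1 := by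
    intro n
    induction n with
    | zero => simpa using (qz (fun _ => 1)).le
    | succ n ih =>
      have := srw_rec G Z hdeg a n (fun _ => 1)
      simp only [mul_one] at this
      refine le_trans (le_of_eq this) (le_trans (Finset.sum_le_sum fun y _ => ?_) ih)
      split_ifs with hy
      · exact q0 n y
      · have := hdeg y hy
        simp [div_self this.ne', hq]
  obtain ⟨k, hkz, hk⟩ := exists_h G hconn Z hZ hdeg (fun _ => 1)
  have hbd : ∀ u : V → ℝ, ∃ C, ∀ y, |u y| ≤ C := by
    intro u
    have : Nonempty V := ⟨a⟩
    obtain ⟨m, hm⟩ := Finite.exists_max (fun y => |u y|)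
    exact ⟨_, hm⟩
  set A : ℕ → ℝ := fun t => ∑ y, if y ∈ Z then 0 else q t y with hA
  have A0 : ∀ t, 0 ≤ A t := fun t => Finset.sum_nonneg fun y _ => by
    split_ifs
    · exact le_rfl
    · exact q0 t y
  have hAs : Summable A := by
    obtain ⟨C, hC⟩ := hbd k
    have C0 : 0 ≤ C := le_trans (abs_nonneg _) (hC a)
    refine summable_of_sum_range_le (c := k a + C) A0 fun n => ?_
    have e := tel (fun _ => 1) k hkz hk n
    simp only [mul_one] at e
    have : -(∑ y, q n y * k y) ≤ C := by
      rw [← Finset.sum_neg_distrib]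
      calc ∑ y, -(q n y * k y) ≤ ∑ y, q n y * C := Finset.sum_le_sum fun y _ => by
            nlinarith [q0 n y, hC y, neg_abs_le (k y)]
        _ = (∑ y, q n y) * C := by rw [Finset.sum_mul]
        _ ≤ 1 * C := by gcongr; exact mass n
        _ = C := one_mul C
    simp only [hA]
    linarith
  have hE : Tendsto (fun n => ∑ y, q n y * h y) atTop (nhds 0) := by
    obtain ⟨C, hC⟩ := hbd h
    refine squeeze_zero_norm (a := fun n => A n * C) (fun n => ?_) ?_
    · refine (norm_sum_le _ _).trans ?_
      simp only [hA, Finset.sum_mul]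
      refine Finset.sum_le_sum fun y _ => ?_
      by_cases hy : y ∈ Z
      · simp [hy, hz y hy]
      · simp only [hy, if_false, norm_mul, Real.norm_eq_abs, abs_of_nonneg (q0 n y)]
        exact mul_le_mul_of_nonneg_left (hC y) (q0 n y)
    · simpa using hAs.tendsto_atTop_zero.mul_const C
  have hS : Tendsto (fun n => ∑ t ∈ Finset.range n, q t x) atTop (nhds (h a)) := by
    have e := tel _ h hz hh
    have e2 : ∀ t, (∑ y, if y ∈ Z then 0 else q t y * (if y = x then 1 else 0)) = q t x := by
      intro t
      rw [Finset.sum_eq_single x]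
      · simp [hx]
      · intro b _ hb; simp [hb]
      · simp
    simp only [e2] at e
    simp only [e]
    simpa using hE.const_sub (h a)
  rw [green, Set.indicator_of_mem (by simpa using hx)]
  refine tendsto_nhds_unique (ENNReal.tendsto_nat_tsum _) ?_
  refine (ENNReal.tendsto_ofReal hS).congr fun n => ?_
  rw [ENNReal.ofReal_sum_of_nonneg (fun t _ => q0 t x)]
  exact Finset.sum_congr rfl fun t _ => ENNReal.ofReal_toReal (srw_ne_top G Z hdeg a t x)

end Helpers

/-- on a finite simple connected graph with nonempty sink, the occupation rate
`S_n(ρ,x)/n` of the rotor walk started at `a` converges to the Green function `G(a,x)`. -/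
theorem occupation_rate_tendsto_green_finite
    {V : Type*} [DecidableEq V] [Fintype V]
    (G : SimpleGraph V) [G.LocallyFinite] (hconn : G.Connected)
    (Z : Set V) (hZ : Z.Nonempty)
    (τ : V → V → V) (hτ : ValidMechanism G Z τ)
    (a : V) (ρ : V → V) (hρ : ValidConfig G Z ρ) (x : V) :
    Tendsto (fun n : ℕ => (Svis τ Z a ρ n x : ℝ≥0∞) / (n : ℝ≥0∞)) atTop
      (nhds (green G Z a x)) := by
  classical
  by_cases hx : x ∈ Z
  · have h0 : ∀ n, Svis τ Z a ρ n x = 0 := by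
      intro n
      refine Finset.sum_eq_zero fun i _ => ?_
      rw [odometer, Set.encard_eq_zero, Set.eq_empty_iff_forall_notMem]
      rintro t ⟨h1, h2⟩
      exact h1 t le_rfl (h2 ▸ hx)
    have hg : green G Z a x = 0 := by
      rw [green, Set.indicator_of_notMem (by simpa using hx)]
    simp [h0, hg]
  have hdeg : ∀ y ∉ Z, (0 : ℝ) < G.degree y := by
    intro y hy
    have := (G.degree_pos_iff_exists_adj y).2 ⟨_, hρ y hy⟩
    exact_mod_cast this
  obtain ⟨h, hz, hh⟩ := exists_h G hconn Z hZ hdeg (fun y => if y = x then 1 else 0)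
  obtain ⟨Ψ, hΨ⟩ := exists_Psi G Z hdeg τ hτ _ h hh
  rw [green_eq G hconn Z hZ hdeg a x hx h hz hh]
  have hval : ∀ i, ValidConfig G Z ((finalConf τ Z a)^[i] ρ) := by
    intro i
    induction i with
    | zero => exact hρ
    | succ i ih =>
      rw [Function.iterate_succ_apply']
      exact (odo G hconn Z hZ hdeg τ hτ x h Ψ hz hΨ a _ ih).1
  have hk : ∀ n : ℕ, ∃ m : ℕ, Svis τ Z a ρ n x = m ∧
      (m : ℝ) = n * h a + Ψ ρ - Ψ ((finalConf τ Z a)^[n] ρ) := by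
    intro n
    induction n with
    | zero => exact ⟨0, by simp [Svis], by simp⟩
    | succ n ih =>
      obtain ⟨m, e1, e2⟩ := ih
      obtain ⟨m', f1, f2⟩ := (odo G hconn Z hZ hdeg τ hτ x h Ψ hz hΨ a _ (hval n)).2
      refine ⟨m + m', ?_, ?_⟩
      · rw [Svis, Finset.sum_range_succ, f1]
        rw [Svis] at e1
        rw [e1]
        push_cast
        rfl
      · rw [Function.iterate_succ_apply']
        push_cast
        linarith
  choose m hm1 hm2 using hk
  obtain ⟨C, hC⟩ : ∃ C, ∀ σ, |Ψ σ| ≤ C := by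
    have : Nonempty (V → V) := ⟨ρ⟩
    obtain ⟨w, hw⟩ := Finite.exists_max (fun σ => |Ψ σ|)
    exact ⟨_, hw⟩
  have hlim : Tendsto (fun n : ℕ => (m n : ℝ) / n) atTop (nhds (h a)) := by
    have hr : Tendsto (fun n : ℕ => (Ψ ρ - Ψ ((finalConf τ Z a)^[n] ρ)) / (n : ℝ)) atTop
        (nhds 0) := by
      refine squeeze_zero_norm (a := fun n : ℕ => (2 * C) / (n : ℝ)) (fun n => ?_)
        (tendsto_const_div_atTop_nhds_zero_nat _)
      rw [norm_div, Real.norm_natCast, Real.norm_eq_abs]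
      gcongr
      have := abs_sub (Ψ ρ) (Ψ ((finalConf τ Z a)^[n] ρ))
      linarith [hC ρ, hC ((finalConf τ Z a)^[n] ρ)]
    have := hr.const_add (h a)
    rw [add_zero] at this
    refine this.congr' ?_
    filter_upwards [eventually_gt_atTop 0] with n hn
    have : (0 : ℝ) < n := by exact_mod_cast hn
    rw [hm2]
    field_simp
    ring
  refine (ENNReal.tendsto_ofReal hlim).congr' ?_
  filter_upwards [eventually_gt_atTop 0] with n hn
  have : (0 : ℝ) < n := by exact_mod_cast hn
  rw [hm1, ENNReal.ofReal_div_of_pos this]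
  simp
end RotorWalk
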